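/- Fix n ≥ 1 and let M = E_1^{(n)} E_2^{(n−1)} ⋯ E_{n−1}^{(2)} E_n · E_1 E_2^{(2)} ⋯ E_{n−1}^{(n−1)} E_n^{(n)} ∈ U. Then M = Σ_{y ∈ 𝒫} λ_y · E(y'), where the sum is over all tuples y = (y_1, …, y_{n−1}) of nonnegative integers with y_k ≤ min(k, n−k) for all k, and (with the convention y_0 = y_n = 0) λ_y = v^{ − Σ_{k=1}^{n−1} (k − y_k)(n − k − y_k) } · Π_{k=1}^{n} binom( n + 1 − y_{k−1} − y_k , k − y_k )_v. -/

import Mathlib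

noncomputable section

/-- The base field `K = ℚ(v)`. -/
abbrev K : Type := RatFunc ℚ

/-- The variable `v ∈ ℚ(v)`. -/
noncomputable def v : K := RatFunc.X

/-- The quantum integer `[k]_v = (v^k - v^{-k})/(v - v^{-1})`. -/
noncomputable def qint (k : ℕ) : K := (v ^ k - v⁻¹ ^ k) / (v - v⁻¹)

/-- The quantum factorial `[k]_v!`. -/
noncomputable def qfact : ℕ → K
  | 0 => 1
  | k + 1 => qint (k + 1) * qfact k

/-- The quantum binomial coefficient `binom(k, m)_v`. -/
noncomputable def qbinom (k m : ℕ) : K := qfact k / (qfact m * qfact (k - m))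

/-- The defining relations of `U_v^+(sl_{n+1})`: commutation for distant indices
and the quantum Serre relations for adjacent indices. -/
inductive SerreRel (n : ℕ) : FreeAlgebra K (Fin n) → FreeAlgebra K (Fin n) → Prop
  | comm (i j : Fin n) (h : (i : ℕ) + 1 < (j : ℕ)) :
      SerreRel n (FreeAlgebra.ι K i * FreeAlgebra.ι K j) (FreeAlgebra.ι K j * FreeAlgebra.ι K i)
  | serre (i j : Fin n) (h : (i : ℕ) + 1 = (j : ℕ) ∨ (j : ℕ) + 1 = (i : ℕ)) :
      SerreRel n (FreeAlgebra.ι K i ^ 2 * FreeAlgebra.ι K j + FreeAlgebra.ι K j * FreeAlgebra.ι K i ^ 2)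
        ((v + v⁻¹) • (FreeAlgebra.ι K i * FreeAlgebra.ι K j * FreeAlgebra.ι K i))

/-- The algebra `U = U_v^+(sl_{n+1})`, presented by generators `E_1, …, E_n` and the
quantum Serre relations. -/
abbrev Uq (n : ℕ) := RingQuot (SerreRel n)

/-- The Chevalley generator `E_i ∈ U` for `1 ≤ i ≤ n` (junk value `0` outside this range). -/
noncomputable def E (n : ℕ) (i : ℕ) : Uq n :=
  if h : i - 1 < n ∧ 1 ≤ i then
    RingQuot.mkAlgHom K (SerreRel n) (FreeAlgebra.ι K (⟨i - 1, h.1⟩ : Fin n)) else 0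

/-- The divided power `u^{(r)} = u^r / [r]_v!`. -/
noncomputable def dp (n : ℕ) (u : Uq n) (r : ℕ) : Uq n := (qfact r)⁻¹ • u ^ r

/-- The root vector `E_{i,i+1} = E_{i+1}E_i - v^{-1}E_iE_{i+1}`. -/
noncomputable def Ebr (n : ℕ) (i : ℕ) : Uq n :=
  E n (i + 1) * E n i - v⁻¹ • (E n i * E n (i + 1))

/-- The ordered product `g 1 * g 2 * ⋯ * g n` in `U`. -/
noncomputable def Eprod (n : ℕ) (g : ℕ → Uq n) : Uq n :=
  ((List.range n).map fun k => g (k + 1)).prod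

/-- Extension of a tuple `(x_1, …, x_{n-1})` (given as a function on `Fin (n-1)`)
to a function on `ℕ`, with the convention `x_k = 0` for `k = 0` and `k ≥ n`. -/
def tup (n : ℕ) (x : Fin (n - 1) → ℕ) (k : ℕ) : ℕ :=
  if h : k - 1 < n - 1 ∧ 1 ≤ k then x ⟨k - 1, h.1⟩ else 0


theorem v_ne_zero : v ≠ 0 := RatFunc.X_ne_zero

theorem v_pow_ne_one (k : ℕ) : v ^ (k + 1) ≠ 1 := by
  intro h
  have h' : algebraMap (Polynomial ℚ) K (Polynomial.X ^ (k + 1)) = algebraMap (Polynomial ℚ) K 1 := by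
    rw [map_pow, RatFunc.algebraMap_X, map_one]
    exact h
  have h2 := congrArg Polynomial.natDegree (RatFunc.algebraMap_injective ℚ h')
  simp at h2

theorem v_pow_sub_ne_zero (k : ℕ) : v ^ (k + 1) - v⁻¹ ^ (k + 1) ≠ 0 := by
  intro h
  apply v_pow_ne_one (2 * k + 1)
  have h1 : v ^ (k + 1) * v⁻¹ ^ (k + 1) = 1 := by
    rw [← mul_pow, mul_inv_cancel₀ v_ne_zero, one_pow]
  calc v ^ (2 * k + 1 + 1) = v ^ (k + 1) * v ^ (k + 1) := by ring
    _ = 1 := by rw [sub_eq_zero] at h; nth_rewrite 2 [h]; exact h1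

theorem v_sub_ne_zero : v - v⁻¹ ≠ 0 := by simpa using v_pow_sub_ne_zero 0

theorem qint_succ_ne_zero (k : ℕ) : qint (k + 1) ≠ 0 :=
  div_ne_zero (v_pow_sub_ne_zero k) v_sub_ne_zero

theorem qint_zero : qint 0 = 0 := by simp [qint]

theorem qfact_ne_zero (k : ℕ) : qfact k ≠ 0 := by
  induction k with
  | zero => exact one_ne_zero
  | succ k ih => exact mul_ne_zero (qint_succ_ne_zero k) ih

theorem qint_add (a b : ℕ) : qint (a + b) = v ^ b * qint a + v⁻¹ ^ a * qint b := by
  simp only [qint]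
  rw [mul_div_assoc', mul_div_assoc', ← add_div]
  congr 1
  have h : v ^ b * v⁻¹ ^ b = 1 := by rw [← mul_pow, mul_inv_cancel₀ v_ne_zero, one_pow]
  rw [pow_add, pow_add]
  ring

section DividedPowers

variable {n : ℕ}

theorem dp_zero (u : Uq n) : dp n u 0 = 1 := by simp [dp, qfact]

theorem mul_dp (u : Uq n) (r : ℕ) : u * dp n u r = qint (r + 1) • dp n u (r + 1) := by
  simp only [dp, qfact, mul_smul_comm, smul_smul, pow_succ']
  congr 1
  rw [mul_inv, ← mul_assoc, mul_inv_cancel₀ (qint_succ_ne_zero r), one_mul]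

theorem dp_mul_dp (u : Uq n) (r s : ℕ) :
    dp n u r * dp n u s = qbinom (r + s) s • dp n u (r + s) := by
  simp only [dp, qbinom, smul_mul_smul_comm, smul_smul, pow_add, Nat.add_sub_cancel]
  congr 1
  have := qfact_ne_zero r
  have := qfact_ne_zero s
  have := qfact_ne_zero (r + s)
  field_simp

theorem Commute.dp_dp {a b : Uq n} (h : Commute a b) (r s : ℕ) : Commute (dp n a r) (dp n b s) :=
  ((h.pow_pow r s).smul_left _).smul_right _

theorem mul_pow_of_bracket {a b c : Uq n} (hc : b * a = c + v⁻¹ • (a * b))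
    (hca : c * a = v • (a * c)) (k : ℕ) :
    b * a ^ (k + 1) = v⁻¹ ^ (k + 1) • (a ^ (k + 1) * b) + qint (k + 1) • (a ^ k * c) := by
  induction k with
  | zero =>
    have : qint 1 = 1 := by simp [qint, div_self v_sub_ne_zero]
    simp [hc, this, add_comm]
  | succ k ih =>
    rw [pow_succ a (k + 1), ← mul_assoc, ih, add_mul, smul_mul_assoc, smul_mul_assoc, mul_assoc _ b,
      hc, mul_assoc _ c, hca, qint_add (k + 1) 1]
    have h1 : qint 1 = 1 := by simp [qint, div_self v_sub_ne_zero]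
    rw [h1]
    simp only [mul_add, mul_smul_comm, smul_add, smul_smul, ← mul_assoc, ← pow_succ]
    rw [add_right_comm, ← add_smul, add_comm]
    congr 2
    ring

theorem mul_dp_of_bracket {a b c : Uq n} (hc : b * a = c + v⁻¹ • (a * b))
    (hca : c * a = v • (a * c)) (k : ℕ) :
    b * dp n a (k + 1) = v⁻¹ ^ (k + 1) • (dp n a (k + 1) * b) + dp n a k * c := by
  have := qint_succ_ne_zero k
  have := qfact_ne_zero k
  simp only [dp, mul_smul_comm, mul_pow_of_bracket hc hca, smul_add, smul_smul, smul_mul_assoc,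
    qfact]
  congr 2
  · ring
  · field_simp

theorem mul_dp_of_quasicommute {b c : Uq n} (hbc : b * c = v • (c * b)) (t : ℕ) :
    b * dp n c t = v ^ t • (dp n c t * b) := by
  have h : b * c ^ t = v ^ t • (c ^ t * b) := by
    induction t with
    | zero => simp
    | succ t ih =>
      rw [pow_succ, ← mul_assoc, ih, smul_mul_assoc, mul_assoc, hbc, mul_smul_comm, smul_smul,
        ← mul_assoc, ← pow_succ]
  simp only [dp, mul_smul_comm, h, smul_mul_assoc, smul_smul, mul_comm]

/-- The straightening formula `b^{(m)} a^{(k)} = ∑ v^{-(m-t)(k-t)} a^{(k-t)} c^{(t)} b^{(m-t)}`. -/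
theorem dp_mul_dp_of_bracket {a b c : Uq n} (hc : b * a = c + v⁻¹ • (a * b))
    (hca : c * a = v • (a * c)) (hbc : b * c = v • (c * b)) (m k : ℕ) :
    dp n b m * dp n a k = ∑ t ∈ Finset.range (min k m + 1),
      v ^ (-(((k - t) * (m - t) : ℕ) : ℤ)) • (dp n a (k - t) * dp n c t * dp n b (m - t)) := by
  have hv := v_ne_zero
  let T (m t : ℕ) : Uq n := if t ≤ m then
    v ^ (-(((k - t) * (m - t) : ℕ) : ℤ)) • (dp n a (k - t) * dp n c t * dp n b (m - t)) else 0
  have key (m : ℕ) : dp n b m * dp n a k = ∑ t ∈ Finset.range (k + 1), T m t := by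
    induction m with
    | zero =>
      rw [Finset.sum_range_succ']
      simp [T, dp_zero]
    | succ m ih =>
      let A (t : ℕ) : Uq n := if t ≤ m + 1 then
        (qint (m + 1 - t) * v ^ (t - (k - t : ℕ) - ((k - t) * (m - t) : ℕ) : ℤ)) •
          (dp n a (k - t) * dp n c t * dp n b (m + 1 - t)) else 0
      let B (t : ℕ) : Uq n := if t ≤ m + 1 ∧ t ≤ k then
        (qint t * v ^ (-(((k + 1 - t) * (m + 1 - t) : ℕ) : ℤ))) •
          (dp n a (k - t) * dp n c t * dp n b (m + 1 - t)) else 0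
      have hAB (t : ℕ) (ht : t ≤ k) : qint (m + 1) • T (m + 1) t = A t + B t := by
        by_cases h : t ≤ m + 1
        · obtain ⟨p, rfl⟩ := Nat.exists_eq_add_of_le ht
          obtain ⟨q, hq⟩ := Nat.exists_eq_add_of_le h
          simp only [T, A, B, h, ht, and_self, if_true, smul_smul, ← add_smul]
          congr 1
          have e1 : m + 1 - t = q := by omega
          have e2 : t + p - t = p := by omega
          have e3 : t + p + 1 - t = p + 1 := by omega
          rw [e1, e2, e3, hq, add_comm t q, qint_add]
          rcases q with _ | q
          · simp [qint_zero]
          · have e4 : m - t = q := by omega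
            rw [e4, add_mul]
            congr 1
            · rw [mul_comm (v ^ t), mul_assoc, ← zpow_natCast, ← zpow_add₀ hv]
              congr 2
              push_cast; ring
            · rw [inv_pow, ← zpow_natCast, ← zpow_neg, mul_comm (v ^ _), mul_assoc, ← zpow_add₀ hv]
              congr 2
              push_cast; ring
        · simp [T, A, B, h]
      have hb (t : ℕ) (ht : t ≤ k) : b * T m t = A t + B (t + 1) := by
        by_cases h : t ≤ m
        · obtain ⟨p, rfl⟩ := Nat.exists_eq_add_of_le ht
          obtain ⟨q, rfl⟩ := Nat.exists_eq_add_of_le h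
          have e1 : t + q + 1 - t = q + 1 := by omega
          have e2 : t + q + 1 - (t + 1) = q := by omega
          have e3 : t + p + 1 - (t + 1) = p := by omega
          have e4 : t + p - (t + 1) = p - 1 := by omega
          have h1 : t ≤ t + q + 1 := by omega
          have h2 : t + 1 ≤ t + q + 1 := by omega
          have hA : b * (dp n c t * dp n b q) =
              (v ^ t * qint (q + 1)) • (dp n c t * dp n b (q + 1)) := by
            rw [← mul_assoc, mul_dp_of_quasicommute hbc, smul_mul_assoc, mul_assoc, mul_dp,
              mul_smul_comm, smul_smul]
          simp only [T, A, B, h, h1, h2, if_true, true_and, e1, e2, e3, e4, Nat.add_sub_cancel_left]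
          rcases p with _ | p
          · simp [dp_zero, hA, mul_comm]
          · have h3 : t + 1 ≤ t + (p + 1) := by omega
            simp only [h3, if_true, mul_smul_comm, Nat.add_sub_cancel]
            rw [mul_assoc, ← mul_assoc b, mul_dp_of_bracket hc hca, add_mul (v⁻¹ ^ (p + 1) • _),
              smul_mul_assoc, mul_assoc _ b, hA, mul_assoc _ c, ← mul_assoc c, mul_dp]
            simp only [smul_add, mul_smul_comm, smul_mul_assoc, smul_smul, mul_assoc]
            congr 2
            · rw [inv_pow, ← zpow_natCast, ← zpow_neg, ← zpow_natCast v t, mul_comm (qint _),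
                ← mul_assoc, ← mul_assoc, ← zpow_add₀ hv, ← zpow_add₀ hv]
              congr 2
              push_cast; ring
            · rw [mul_comm]
        · have h1 : ¬ t + 1 ≤ m + 1 := by omega
          simp only [T, A, B, h, h1, if_false, false_and, mul_zero, add_zero]
          split_ifs with h2
          · have : m + 1 - t = 0 := by omega
            simp [this, qint_zero]
          · rfl
      have hB0 : B 0 = 0 := by simp [B, qint_zero]
      have hBk : B (k + 1) = 0 := by simp [B]
      have hq := qint_succ_ne_zero m
      apply smul_right_injective (Uq n) hq
      simp only
      rw [← smul_mul_assoc, ← mul_dp, mul_assoc, ih, Finset.mul_sum, Finset.smul_sum,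
        Finset.sum_congr rfl fun t ht => hb t (Finset.mem_range_succ_iff.1 ht),
        Finset.sum_congr rfl fun t ht => hAB t (Finset.mem_range_succ_iff.1 ht),
        Finset.sum_add_distrib, Finset.sum_add_distrib]
      congr 1
      have := (Finset.sum_range_succ B (k + 1)).symm.trans (Finset.sum_range_succ' B (k + 1))
      rwa [hB0, hBk, add_zero, add_zero, eq_comm] at this
  rw [key]
  symm
  have hsub : Finset.range (min k m + 1) ⊆ Finset.range (k + 1) := by
    apply Finset.range_subset_range.2; omega
  rw [← Finset.sum_subset hsub]
  · refine Finset.sum_congr rfl fun t ht => ?_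
    rw [Finset.mem_range] at ht
    simp only [T]
    rw [if_pos (by omega)]
  · intro t ht ht'
    rw [Finset.mem_range] at ht ht'
    simp only [T]
    rw [if_neg (by omega)]

end DividedPowers

section Relations

variable {n : ℕ}

theorem E_succ {i : ℕ} (h : i < n) :
    E n (i + 1) = RingQuot.mkAlgHom K (SerreRel n) (FreeAlgebra.ι K (⟨i, h⟩ : Fin n)) := by
  simp [E, h]

theorem E_commute {i j : ℕ} (h : i + 1 < j) : Commute (E n i) (E n j) := by
  by_cases hi : i - 1 < n ∧ 1 ≤ i
  · by_cases hj : j - 1 < n ∧ 1 ≤ j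
    · simp only [E, dif_pos hi, dif_pos hj, Commute, SemiconjBy, ← map_mul]
      exact RingQuot.mkAlgHom_rel K (SerreRel.comm _ _ (by simp only; omega))
    · simp [E, dif_neg hj]
  · simp [E, dif_neg hi]

theorem E_serre {i j : ℕ} (hi : i < n) (hj : j < n) (h : i + 1 = j ∨ j + 1 = i) :
    E n (i + 1) ^ 2 * E n (j + 1) + E n (j + 1) * E n (i + 1) ^ 2 =
      (v + v⁻¹) • (E n (i + 1) * E n (j + 1) * E n (i + 1)) := by
  rw [E_succ hi, E_succ hj]
  simpa using RingQuot.mkAlgHom_rel K (SerreRel.serre (⟨i, hi⟩ : Fin n) ⟨j, hj⟩ h)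

theorem E_succ_mul_E (i : ℕ) :
    E n (i + 1) * E n i = Ebr n i + v⁻¹ • (E n i * E n (i + 1)) := by
  simp [Ebr]

theorem Ebr_mul_E {i : ℕ} (h : i + 1 < n) :
    Ebr n (i + 1) * E n (i + 1) = v • (E n (i + 1) * Ebr n (i + 1)) := by
  have hs := E_serre (n := n) (i := i) (j := i + 1) (by omega) h (Or.inl rfl)
  have hv := v_ne_zero
  simp only [Ebr, sub_mul, mul_sub, smul_sub, smul_mul_assoc, mul_smul_comm, smul_smul,
    mul_inv_cancel₀ hv, one_smul]
  rw [add_smul, pow_two] at hs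
  simp only [mul_assoc] at hs ⊢
  rw [sub_eq_sub_iff_add_eq_add, add_comm, add_comm (_ • _), hs, add_comm]

theorem E_mul_Ebr {i : ℕ} (h : i + 1 < n) :
    E n (i + 2) * Ebr n (i + 1) = v • (Ebr n (i + 1) * E n (i + 2)) := by
  have hs := E_serre (n := n) (i := i + 1) (j := i) h (by omega) (Or.inr rfl)
  have hv := v_ne_zero
  simp only [Ebr, sub_mul, mul_sub, smul_sub, smul_mul_assoc, mul_smul_comm, smul_smul,
    mul_inv_cancel₀ hv, one_smul]
  rw [add_smul, pow_two] at hs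
  simp only [mul_assoc] at hs ⊢
  rw [sub_eq_sub_iff_add_eq_add, hs]

theorem dp_E_succ_mul_dp_E {i : ℕ} (h : i + 1 < n) (m k : ℕ) :
    dp n (E n (i + 2)) m * dp n (E n (i + 1)) k = ∑ t ∈ Finset.range (min k m + 1),
      v ^ (-(((k - t) * (m - t) : ℕ) : ℤ)) •
        (dp n (E n (i + 1)) (k - t) * dp n (Ebr n (i + 1)) t * dp n (E n (i + 2)) (m - t)) :=
  dp_mul_dp_of_bracket (E_succ_mul_E (i + 1)) (Ebr_mul_E h) (E_mul_Ebr h) m k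

end Relations

/-- Interleaving two ordered products when the `i`-th factor of the second one commutes with all
factors of the first one of index at least `i + 2`. -/
theorem prod_map_range_mul_prod_map_range {A : Type*} [Monoid A] (g h : ℕ → A)
    (hgh : ∀ i j, i + 1 < j → Commute (h i) (g j)) (r : ℕ) :
    ((List.range (r + 1)).map g).prod * ((List.range r).map h).prod =
      g 0 * ((List.range r).map fun i => g (i + 1) * h i).prod := by
  induction r with
  | zero => simp
  | succ r ih =>
    have hc : Commute ((List.range r).map h).prod (g (r + 1)) := by
      apply Commute.list_prod_left
      intro x hx
      obtain ⟨i, hi, rfl⟩ := List.mem_map.1 hx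
      exact hgh i _ (by rw [List.mem_range] at hi; omega)
    rw [List.prod_range_succ g (r + 1), List.prod_range_succ h,
      List.prod_range_succ (fun i => g (i + 1) * h i), mul_assoc,
      ← mul_assoc (g (r + 1)), ← hc.eq, mul_assoc _ (g (r + 1)), ← mul_assoc, ih, mul_assoc]

theorem prod_map_range_sum {n : ℕ} (r : ℕ) (s : ℕ → Finset ℕ) (f : ℕ → ℕ → Uq n) :
    ((List.range r).map fun i => ∑ t ∈ s i, f i t).prod =
      ∑ y ∈ Fintype.piFinset fun i : Fin r => s i, (List.ofFn fun i : Fin r => f i (y i)).prod := by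
  have := (MultilinearMap.mkPiAlgebraFin K r (Uq n)).map_sum_finset
    (fun (i : Fin r) t => f i t) (fun i => s i)
  simp only [MultilinearMap.mkPiAlgebraFin_apply] at this
  rw [← this, List.ofFn_eq_map, ← List.map_coe_finRange_eq_range, List.map_map]
  rfl

/-- Merging neighbouring divided powers of the same generator in an ordered product. -/
theorem prod_map_range_regroup {n N : ℕ} (z : ℕ → ℕ) (e : ℕ → ℤ) (x c : ℕ → Uq n) (hz : z 0 = 0)
    (r : ℕ) (h1 : ∀ k ≤ r, z k ≤ k) (h2 : ∀ k ≤ r, k + z k ≤ N) :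
    dp n (x 1) N * ((List.range r).map fun i => v ^ e (i + 1) •
        (dp n (x (i + 1)) (i + 1 - z (i + 1)) * c (i + 1) *
          dp n (x (i + 2)) (N - (i + 1) - z (i + 1)))).prod =
      (v ^ (∑ k ∈ Finset.Icc 1 r, e k) *
        ∏ k ∈ Finset.Icc 1 r, qbinom (N + 1 - z (k - 1) - z k) (k - z k)) •
      (((List.range r).map fun i =>
        dp n (x (i + 1)) (N + 1 - z i - z (i + 1)) * c (i + 1)).prod *
          dp n (x (r + 1)) (N - r - z r)) := by
  have hv := v_ne_zero
  induction r with
  | zero => simp [hz]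
  | succ r ih =>
    have i1 := h1 (r + 1) le_rfl
    have i2 := h2 (r + 1) le_rfl
    have i3 := h1 r (by omega)
    have i4 := h2 r (by omega)
    have hN : N - r - z r + (r + 1 - z (r + 1)) = N + 1 - z r - z (r + 1) := by omega
    rw [List.prod_range_succ, List.prod_range_succ, ← mul_assoc,
      ih (fun k hk => h1 k (by omega)) (fun k hk => h2 k (by omega)),
      Finset.sum_Icc_succ_top (by omega), Finset.prod_Icc_succ_top (by omega), zpow_add₀ hv,
      smul_mul_smul_comm, mul_assoc (List.prod _), ← mul_assoc (dp n (x (r + 1)) _),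
      ← mul_assoc (dp n (x (r + 1)) _), dp_mul_dp, hN]
    simp only [smul_mul_assoc, mul_smul_comm, smul_smul, mul_assoc, Nat.add_sub_cancel]
    congr 1
    ring

/-- the expansion of the monomial
`M = E_1^{(n)} E_2^{(n-1)} ⋯ E_n · E_1 E_2^{(2)} ⋯ E_n^{(n)}` into the PBW basis
elements `E(y')` for `y ∈ 𝒫 = {y : y_k ≤ min(k, n-k)}`, with coefficients `λ_y`. -/
theorem stmt16 (n : ℕ) (hn : 1 ≤ n) :
    Eprod n (fun i => dp n (E n i) (n + 1 - i)) * Eprod n (fun i => dp n (E n i) i) =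
    ∑ y ∈ Fintype.piFinset
        (fun i : Fin (n - 1) => Finset.range (min ((i : ℕ) + 1) (n - ((i : ℕ) + 1)) + 1)),
      (v ^ (-((∑ k ∈ Finset.Icc 1 (n - 1),
            (k - tup n y k) * (n - k - tup n y k) : ℕ) : ℤ)) *
        ∏ k ∈ Finset.Icc 1 n,
          qbinom (n + 1 - tup n y (k - 1) - tup n y k) (k - tup n y k)) •
      Eprod n (fun k =>
        dp n (E n k) (n + 1 - tup n y (k - 1) - tup n y k) * dp n (Ebr n k) (tup n y k)) := by
  obtain ⟨N, rfl⟩ := Nat.exists_eq_add_of_le' hn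
  unfold Eprod
  rw [List.prod_range_succ (fun k => dp (N + 1) (E (N + 1) (k + 1)) (k + 1)), ← mul_assoc,
    prod_map_range_mul_prod_map_range _ _ fun i j hij =>
      (E_commute (by omega)).dp_dp _ _]
  have hsum (i : ℕ) (hi : i ∈ List.range N) :
      dp (N + 1) (E (N + 1) (i + 1 + 1)) (N + 1 + 1 - (i + 1 + 1)) *
        dp (N + 1) (E (N + 1) (i + 1)) (i + 1) = _ :=
    dp_E_succ_mul_dp_E (by rw [List.mem_range] at hi; omega) _ _
  rw [List.map_congr_left hsum, prod_map_range_sum N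
    (fun i => Finset.range (min (i + 1) (N + 1 + 1 - (i + 1 + 1)) + 1)), Finset.mul_sum,
    Finset.sum_mul]
  refine Finset.sum_congr (by congr! 3; omega) fun y hy => ?_
  have hy' (i : Fin N) : y i ≤ i + 1 ∧ y i ≤ N - i := by
    have := Fintype.mem_piFinset.1 hy i
    rw [Finset.mem_range] at this
    omega
  set z := tup (N + 1) y with hzdef
  have hz0 : z 0 = 0 := by simp [z, tup]
  have hzN : z (N + 1) = 0 := by simp [z, tup]
  have hzi (i : Fin N) : z (i + 1) = y i := by simp [z, tup]
  have hzle (k : ℕ) (hk : k ≤ N) : z k ≤ k ∧ k + z k ≤ N + 1 := by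
    rcases k with _ | k
    · simp [hz0]
    · have := hzi ⟨k, by omega⟩
      have := hy' ⟨k, by omega⟩
      simp only at *
      omega
  have hreg := prod_map_range_regroup z
    (fun k => -(((k - z k) * (N + 1 - k - z k) : ℕ) : ℤ)) (E (N + 1))
    (fun k => dp (N + 1) (Ebr (N + 1) k) (z k)) hz0 N (fun k hk => (hzle k hk).1)
    (fun k hk => (hzle k hk).2)
  have hof : List.ofFn (fun i : Fin N =>
      v ^ (-(((i + 1 - y i) * (N + 1 + 1 - (i + 1 + 1) - y i) : ℕ) : ℤ)) •
        (dp (N + 1) (E (N + 1) (i + 1)) (i + 1 - y i) * dp (N + 1) (Ebr (N + 1) (i + 1)) (y i) *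
          dp (N + 1) (E (N + 1) (i + 2)) (N + 1 + 1 - (i + 1 + 1) - y i))) =
      (List.range N).map fun i =>
        v ^ (-(((i + 1 - z (i + 1)) * (N + 1 - (i + 1) - z (i + 1)) : ℕ) : ℤ)) •
        (dp (N + 1) (E (N + 1) (i + 1)) (i + 1 - z (i + 1)) *
          dp (N + 1) (Ebr (N + 1) (i + 1)) (z (i + 1)) *
          dp (N + 1) (E (N + 1) (i + 2)) (N + 1 - (i + 1) - z (i + 1))) := by
    rw [List.ofFn_eq_map, ← List.map_coe_finRange_eq_range, List.map_map]
    refine List.map_congr_left fun i _ => ?_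
    simp only [Function.comp, hzi, Nat.add_sub_add_right]
  have hlast : N + 1 - N - z N + (N + 1) = N + 1 + 1 - z N := by
    have := (hzle N le_rfl).2
    omega
  rw [hof]
  simp only [Nat.zero_add, Nat.add_sub_cancel]
  rw [hreg, List.prod_range_succ, smul_mul_assoc, mul_assoc, dp_mul_dp, hlast, mul_smul_comm,
    smul_smul,
    Finset.prod_Icc_succ_top (by omega), hzN, dp_zero]
  simp only [Nat.add_sub_cancel, Nat.sub_zero, mul_one, mul_assoc, Nat.cast_sum,
    Finset.sum_neg_distrib]

end
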